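/- The complement in ℝ^{n+1}/ℝ·(1,…,1) of the Shi arrangement (hyperplanes z_b - z_a = 0 and z_b - z_a = 1 for a < b) has exactly (n+2)^n connected components. -/

import Mathlib

/-- The diagonal line `ℝ·(1,…,1)` in `ℝ^{n+1}`. -/
noncomputable def diagLine (n : ℕ) : Submodule ℝ (Fin (n + 1) → ℝ) :=
  Submodule.span ℝ {fun _ => (1 : ℝ)}

open Filter Topology Polynomial

section GainGraph

variable {V : Type}

/-- A list of triples `(a, b, g)` stands for the hyperplanes `z b - z a = g`; the point `z` avoids
the list if it lies on none of them. -/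
def Avoids {K : Type*} [Ring K] (L : List (V × V × ℤ)) (z : V → K) : Prop :=
  ∀ t ∈ L, z t.2.1 - z t.1 ≠ (t.2.2 : K)

/-- The side of each hyperplane of `L` on which `z` lies. -/
def signs (L : List (V × V × ℤ)) (z : V → ℝ) : List Prop :=
  L.map fun t => (t.2.2 : ℝ) < z t.2.1 - z t.1

/-- The sign vectors realized on the complement of the arrangement `L`. -/
def regions (L : List (V × V × ℤ)) : Set (List Prop) :=
  signs L '' {z | Avoids L z}

lemma avoids_cons {K : Type*} [Ring K] (t : V × V × ℤ) (L : List (V × V × ℤ)) (z : V → K) :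
    Avoids (t :: L) z ↔ z t.2.1 - z t.1 ≠ (t.2.2 : K) ∧ Avoids L z := by
  simp [Avoids]

lemma signs_eq_iff (L : List (V × V × ℤ)) (z w : V → ℝ) :
    signs L z = signs L w ↔
      ∀ t ∈ L, ((t.2.2 : ℝ) < z t.2.1 - z t.1 ↔ (t.2.2 : ℝ) < w t.2.1 - w t.1) := by
  simp only [signs, List.map_inj_left, eq_iff_iff]

lemma finite_regions (L : List (V × V × ℤ)) : (regions L).Finite := by
  refine (List.finite_length_eq Prop L.length).subset ?_
  rintro _ ⟨z, -, rfl⟩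
  simp [signs]

lemma eventually_avoids_signs_eq (L : List (V × V × ℤ)) {z : V → ℝ} (hz : Avoids L z) :
    ∀ᶠ w in 𝓝 z, Avoids L w ∧ signs L w = signs L z := by
  have key : ∀ᶠ w in 𝓝 z, ∀ t ∈ {t | t ∈ L}, w t.2.1 - w t.1 ≠ (t.2.2 : ℝ) ∧
      ((t.2.2 : ℝ) < w t.2.1 - w t.1 ↔ (t.2.2 : ℝ) < z t.2.1 - z t.1) := by
    rw [Filter.eventually_all_finite L.finite_toSet]
    intro t ht
    have hc : Continuous fun w : V → ℝ => w t.2.1 - w t.1 := by fun_prop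
    rcases lt_or_gt_of_ne (hz t ht) with h | h
    · filter_upwards [hc.continuousAt.eventually_lt continuousAt_const h] with w hw
      exact ⟨hw.ne, ⟨fun h' => absurd h' hw.not_gt, fun h' => absurd h' h.not_gt⟩⟩
    · filter_upwards [continuousAt_const.eventually_lt hc.continuousAt h] with w hw
      exact ⟨hw.ne', ⟨fun _ => h, fun _ => hw⟩⟩
  filter_upwards [key] with w hw
  exact ⟨fun t ht => (hw t ht).1, (signs_eq_iff L w z).2 fun t ht => (hw t ht).2⟩

lemma isOpen_avoids_signs_eq (L : List (V × V × ℤ)) (σ : List Prop) :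
    IsOpen {z : V → ℝ | Avoids L z ∧ signs L z = σ} := by
  rw [isOpen_iff_mem_nhds]
  rintro z ⟨hz, rfl⟩
  exact eventually_avoids_signs_eq L hz

lemma convex_avoids_signs_eq (L : List (V × V × ℤ)) (σ : List Prop) :
    Convex ℝ {z : V → ℝ | Avoids L z ∧ signs L z = σ} := by
  rintro x ⟨hx, rfl⟩ y ⟨hy, hxy⟩ u v hu hv huv
  rw [signs_eq_iff] at hxy
  have key : ∀ t ∈ L, (u • x + v • y) t.2.1 - (u • x + v • y) t.1 ≠ (t.2.2 : ℝ) ∧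
      ((t.2.2 : ℝ) < (u • x + v • y) t.2.1 - (u • x + v • y) t.1 ↔
        (t.2.2 : ℝ) < x t.2.1 - x t.1) := by
    intro t ht
    have hcomb : (u • x + v • y) t.2.1 - (u • x + v • y) t.1 =
        u • (x t.2.1 - x t.1) + v • (y t.2.1 - y t.1) := by
      simp only [Pi.add_apply, Pi.smul_apply, smul_eq_mul]; ring
    rw [hcomb]
    rcases lt_or_gt_of_ne (hx t ht) with h | h
    · have h' : y t.2.1 - y t.1 < t.2.2 :=
        lt_of_le_of_ne (not_lt.1 fun h' => h.not_gt ((hxy t ht).1 h')) (hy t ht)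
      have h2 := convex_Iio (t.2.2 : ℝ) h h' hu hv huv
      exact ⟨ne_of_lt h2, ⟨fun h' => absurd h' (not_lt_of_gt h2), fun h' => absurd h' h.not_gt⟩⟩
    · have h2 := convex_Ioi (t.2.2 : ℝ) h ((hxy t ht).2 h) hu hv huv
      exact ⟨ne_of_gt h2, ⟨fun _ => h, fun _ => h2⟩⟩
  exact ⟨fun t ht => (key t ht).1, (signs_eq_iff L _ x).2 fun t ht => (key t ht).2⟩

variable [DecidableEq V]

lemma exists_perturbation (L : List (V × V × ℤ)) {a b : V} (hab : a ≠ b) {z : V → ℝ}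
    (hz : Avoids L z) :
    (∃ w, Avoids L w ∧ signs L w = signs L z ∧ z b - z a < w b - w a) ∧
      ∃ w, Avoids L w ∧ signs L w = signs L z ∧ w b - w a < z b - z a := by
  have hc : Continuous fun ε : ℝ => z + ε • (Pi.single b 1 : V → ℝ) := by fun_prop
  have h0 : Tendsto (fun ε : ℝ => z + ε • (Pi.single b 1 : V → ℝ)) (𝓝 0) (𝓝 z) := by
    simpa using hc.tendsto 0
  have hev := h0.eventually (eventually_avoids_signs_eq L hz)
  obtain ⟨ε, hε, hpos⟩ := ((hev.filter_mono nhdsWithin_le_nhds).and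
    (self_mem_nhdsWithin : Set.Ioi (0 : ℝ) ∈ 𝓝[>] 0)).exists
  obtain ⟨η, hη, hneg⟩ := ((hev.filter_mono nhdsWithin_le_nhds).and
    (self_mem_nhdsWithin : Set.Iio (0 : ℝ) ∈ 𝓝[<] 0)).exists
  replace hpos : 0 < ε := hpos
  replace hneg : η < 0 := hneg
  refine ⟨⟨_, hε.1, hε.2, ?_⟩, ⟨_, hη.1, hη.2, ?_⟩⟩
  · simp [Pi.single_eq_of_ne hab]; linarith
  · simp [Pi.single_eq_of_ne hab]; linarith

/-- The vertex map of the contraction of the edge from `a` to `b`. -/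
def contractVertex {a b : V} (hab : a ≠ b) (v : V) : {v : V // v ≠ b} :=
  if hv : v = b then ⟨a, hab⟩ else ⟨v, hv⟩

/-- The potential shift of the contraction of an edge of gain `g` ending at `b`. -/
def contractShift (b : V) (g : ℤ) (v : V) : ℤ := if v = b then g else 0

/-- The point of the hyperplane `z b - z a = g` with given coordinates away from `b`. -/
def extendPoint {K : Type*} [Ring K] {a b : V} (hab : a ≠ b) (g : ℤ) (w : {v : V // v ≠ b} → K)
    (v : V) : K :=
  w (contractVertex hab v) + contractShift b g v

/-- The restriction of the arrangement `L` to the hyperplane `z b - z a = g`. -/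
def contractList {a b : V} (hab : a ≠ b) (g : ℤ) (L : List (V × V × ℤ)) :
    List ({v : V // v ≠ b} × {v : V // v ≠ b} × ℤ) :=
  L.map fun t => (contractVertex hab t.1, contractVertex hab t.2.1,
    t.2.2 - contractShift b g t.2.1 + contractShift b g t.1)

lemma avoids_contractList {K : Type*} [Ring K] {a b : V} (hab : a ≠ b) (g : ℤ)
    (L : List (V × V × ℤ)) (w : {v : V // v ≠ b} → K) :
    Avoids (contractList hab g L) w ↔ Avoids L (extendPoint hab g w) := by
  simp only [Avoids, contractList, List.forall_mem_map, extendPoint]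
  refine forall₂_congr fun t _ => not_congr ?_
  push_cast
  constructor <;> intro h
  · rw [add_sub_add_comm, h]; abel
  · rw [← h]; abel

lemma signs_contractList {a b : V} (hab : a ≠ b) (g : ℤ)
    (L : List (V × V × ℤ)) (w : {v : V // v ≠ b} → ℝ) :
    signs (contractList hab g L) w = signs L (extendPoint hab g w) := by
  simp only [signs, contractList, List.map_map, List.map_inj_left, extendPoint, Function.comp]
  intro t _
  push_cast
  exact propext ⟨fun h => by linarith, fun h => by linarith⟩

lemma extendPoint_sub {K : Type*} [Ring K] {a b : V} (hab : a ≠ b) (g : ℤ)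
    (w : {v : V // v ≠ b} → K) : extendPoint hab g w b - extendPoint hab g w a = g := by
  simp [extendPoint, contractVertex, contractShift, hab]

lemma extendPoint_restrict {K : Type*} [Ring K] {a b : V} (hab : a ≠ b) (g : ℤ) {z : V → K}
    (hz : z b - z a = g) : extendPoint hab g (fun v => z v) = z := by
  funext v
  by_cases hv : v = b
  · subst hv
    simp [extendPoint, contractVertex, contractShift, ← hz]
  · simp [extendPoint, contractVertex, contractShift, hv]

lemma extendPoint_injective {K : Type*} [Ring K] {a b : V} (hab : a ≠ b) (g : ℤ) :
    Function.Injective (extendPoint (K := K) hab g) := by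
  intro w w' h
  funext v
  have := congrFun h v
  simpa [extendPoint, contractVertex, contractShift, v.2] using this

/-- Deletion and restriction for the number of regions. -/
lemma ncard_regions_cons {a b : V} (hab : a ≠ b) (g : ℤ) (L : List (V × V × ℤ)) :
    (regions ((a, b, g) :: L)).ncard =
      (regions L).ncard + (regions (contractList hab g L)).ncard := by
  set P : Set (List Prop) := signs L '' {z | Avoids L z ∧ (g : ℝ) < z b - z a}
  set M : Set (List Prop) := signs L '' {z | Avoids L z ∧ z b - z a < (g : ℝ)}
  have hunion : P ∪ M = regions L := by
    ext σ
    constructor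
    · rintro (⟨z, hz, rfl⟩ | ⟨z, hz, rfl⟩) <;> exact ⟨z, hz.1, rfl⟩
    · rintro ⟨z, hz, rfl⟩
      rcases lt_trichotomy (z b - z a) g with h | h | h
      · exact Or.inr ⟨z, ⟨hz, h⟩, rfl⟩
      · obtain ⟨⟨w, hw, hs, hlt⟩, -⟩ := exists_perturbation L hab hz
        exact Or.inl ⟨w, ⟨hw, h ▸ hlt⟩, hs⟩
      · exact Or.inl ⟨z, ⟨hz, h⟩, rfl⟩
  have hinter : P ∩ M = regions (contractList hab g L) := by
    ext σ
    constructor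
    · rintro ⟨⟨x, ⟨hx, hxg⟩, rfl⟩, ⟨y, ⟨hy, hyg⟩, hs⟩⟩
      set d := (x b - x a) - (y b - y a) with hd
      have hdpos : 0 < d := by linarith
      have hmem := convex_avoids_signs_eq L (signs L x)
        (show x ∈ {z | Avoids L z ∧ signs L z = signs L x} from ⟨hx, rfl⟩)
        (show y ∈ {z | Avoids L z ∧ signs L z = signs L x} from ⟨hy, hs⟩)
        (a := (g - (y b - y a)) / d) (b := ((x b - x a) - g) / d)
        (div_nonneg (by linarith) hdpos.le) (div_nonneg (by linarith) hdpos.le)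
        (by field_simp; rw [hd]; ring)
      set z := ((g - (y b - y a)) / d) • x + (((x b - x a) - g) / d) • y with hz
      have hzg : z b - z a = ((g : ℤ) : ℝ) := by
        simp only [hz, Pi.add_apply, Pi.smul_apply, smul_eq_mul]
        field_simp
        rw [hd]; ring
      refine ⟨fun v => z v, ?_, ?_⟩
      · rw [Set.mem_ofPred_eq, avoids_contractList, extendPoint_restrict hab g hzg]
        exact hmem.1
      · rw [signs_contractList, extendPoint_restrict hab g hzg]
        exact hmem.2
    · rintro ⟨w, hw, rfl⟩
      rw [Set.mem_ofPred_eq, avoids_contractList] at hw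
      rw [signs_contractList]
      have he := extendPoint_sub hab g w
      obtain ⟨⟨x, hx, hxs, hlt⟩, ⟨y, hy, hys, hgt⟩⟩ := exists_perturbation L hab hw
      rw [he] at hlt hgt
      exact ⟨⟨x, ⟨hx, hlt⟩, hxs⟩, ⟨y, ⟨hy, hgt⟩, hys⟩⟩
  have hcons : regions ((a, b, g) :: L) = List.cons True '' P ∪ List.cons False '' M := by
    ext σ
    constructor
    · rintro ⟨z, hz, rfl⟩
      rw [Set.mem_ofPred_eq, avoids_cons] at hz
      rcases lt_or_gt_of_ne hz.1 with h | h
      · refine Or.inr ⟨_, ⟨z, ⟨hz.2, h⟩, rfl⟩, ?_⟩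
        simpa [signs] using h.le
      · refine Or.inl ⟨_, ⟨z, ⟨hz.2, h⟩, rfl⟩, ?_⟩
        simpa [signs] using h
    · rintro (⟨_, ⟨z, ⟨hz, h⟩, rfl⟩, rfl⟩ | ⟨_, ⟨z, ⟨hz, h⟩, rfl⟩, rfl⟩)
      · exact ⟨z, (avoids_cons _ _ _).2 ⟨h.ne', hz⟩, by simpa [signs] using h⟩
      · exact ⟨z, (avoids_cons _ _ _).2 ⟨h.ne, hz⟩, by simpa [signs] using h.le⟩
  have hfin : (P ∪ M).Finite := hunion ▸ finite_regions L
  have hPf : P.Finite := hfin.subset Set.subset_union_left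
  have hMf : M.Finite := hfin.subset Set.subset_union_right
  rw [hcons, Set.ncard_union_eq _ (hPf.image _) (hMf.image _),
    Set.ncard_image_of_injective _ List.cons_injective,
    Set.ncard_image_of_injective _ List.cons_injective, ← hunion, ← hinter,
    Set.ncard_union_add_ncard_inter _ _ hPf hMf]
  rw [Set.disjoint_left]
  rintro _ ⟨σ, -, rfl⟩ ⟨τ, -, h⟩
  simp at h

/-- Deletion and restriction for the number of points avoiding the arrangement. -/
lemma ncard_avoids_cons {K : Type*} [Ring K] [Finite K] [Finite V] {a b : V} (hab : a ≠ b) (g : ℤ)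
    (L : List (V × V × ℤ)) :
    {z : V → K | Avoids L z}.ncard = {z : V → K | Avoids ((a, b, g) :: L) z}.ncard +
      {w : {v : V // v ≠ b} → K | Avoids (contractList hab g L) w}.ncard := by
  have himage : extendPoint hab g '' {w : {v : V // v ≠ b} → K | Avoids (contractList hab g L) w} =
      {z : V → K | Avoids L z ∧ z b - z a = g} := by
    ext z
    constructor
    · rintro ⟨w, hw, rfl⟩
      exact ⟨(avoids_contractList hab g L w).1 hw, extendPoint_sub hab g w⟩
    · rintro ⟨hz, hg⟩
      refine ⟨fun v => z v, ?_, extendPoint_restrict hab g hg⟩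
      rw [Set.mem_ofPred_eq, avoids_contractList, extendPoint_restrict hab g hg]
      exact hz
  rw [← Set.ncard_image_of_injective _ (extendPoint_injective hab g), himage,
    ← Set.ncard_union_eq _ (Set.toFinite _) (Set.toFinite _)]
  · congr 1
    ext z
    simp only [Set.mem_ofPred_eq, Set.mem_union, avoids_cons]
    tauto
  · rw [Set.disjoint_left]
    rintro z hz ⟨-, h⟩
    exact ((avoids_cons _ _ _).1 hz).1 h

end GainGraph

/-- **Zaslavsky's theorem** for arrangements of hyperplanes `z b - z a = g`, with the
characteristic polynomial computed by counting points modulo large integers. -/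
theorem exists_characteristic_polynomial {V : Type} (L : List (V × V × ℤ)) [Fintype V] [DecidableEq V] :
    ∃ P : ℤ[X],
      (∀ᶠ q : ℕ in atTop, ({z : V → ZMod q | Avoids L z}.ncard : ℤ) = P.eval (q : ℤ)) ∧
      ((regions L).ncard : ℤ) = (-1) ^ Fintype.card V * P.eval (-1) := by
  obtain ⟨m, hm⟩ : ∃ m, L.length = m := ⟨_, rfl⟩
  induction m generalizing V with
  | zero =>
    obtain rfl := List.length_eq_zero_iff.1 hm
    refine ⟨X ^ Fintype.card V, ?_, ?_⟩
    · filter_upwards [eventually_ge_atTop 1] with q hq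
      have : NeZero q := ⟨by omega⟩
      simp [Avoids, Set.ncard_univ, Nat.card_eq_fintype_card, ZMod.card]
    · have : regions ([] : List (V × V × ℤ)) = {[]} := by
        ext σ
        simp [regions, signs, Avoids, eq_comm]
      simp [this, ← mul_pow]
  | succ m ih =>
    match L, hm with
    | (a, b, g) :: L, hm =>
    have hL : L.length = m := by simpa using hm
    by_cases hab : a = b
    · subst hab
      by_cases hg : g = 0
      · subst hg
        refine ⟨0, ?_, ?_⟩
        · simp [avoids_cons]
        · simp [regions, avoids_cons]
      · obtain ⟨P, hP, hr⟩ := ih L hL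
        refine ⟨P, ?_, ?_⟩
        · filter_upwards [hP, eventually_gt_atTop g.natAbs] with q hq hgq
          rw [← hq]
          have : (0 : ZMod q) ≠ (g : ZMod q) := by
            intro h
            have hdvd := (ZMod.intCast_zmod_eq_zero_iff_dvd g q).1 h.symm
            exact hg (Int.eq_zero_of_abs_lt_dvd hdvd (by rw [Int.abs_eq_natAbs]; omega))
          simp [avoids_cons, this]
        · rw [← hr]
          have hg' : (0 : ℝ) ≠ g := by exact_mod_cast Ne.symm hg
          have : regions ((a, a, g) :: L) = List.cons ((g : ℝ) < 0) '' regions L := by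
            simp [regions, avoids_cons, hg', Set.image_image]
            simp [signs, Set.image]
          rw [this, Set.ncard_image_of_injective _ List.cons_injective]
    · obtain ⟨P, hP, hr⟩ := ih L hL
      obtain ⟨Q, hQ, hs⟩ := ih (contractList hab g L) (by simpa [contractList] using hL)
      refine ⟨P - Q, ?_, ?_⟩
      · filter_upwards [hP, hQ, eventually_ge_atTop 1] with q hp hq h1
        have : NeZero q := ⟨by omega⟩
        rw [eval_sub, ← hp, ← hq, ncard_avoids_cons hab g L]
        push_cast
        ring
      · rw [ncard_regions_cons hab]
        push_cast
        have hcard : Fintype.card V = Fintype.card {v : V // v ≠ b} + 1 := by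
          have := Fintype.card_pos_iff.2 ⟨b⟩
          rw [Fintype.card_subtype_compl, Fintype.card_subtype_eq]
          omega
        rw [hr, hs, hcard, eval_sub]
        ring

section Counting

/-- Placements of labels at distinct positions strictly between `0` and `q` such that no label is
immediately followed by a larger one. -/
def linearPlacements (N q : ℕ) : Set (Fin N → ℕ) :=
  {y | (∀ i, 0 < y i ∧ y i < q) ∧ ∀ a b, a < b → y b ≠ y a ∧ y b ≠ y a + 1}

lemma finite_linearPlacements (N q : ℕ) : (linearPlacements N q).Finite :=
  (Set.Finite.pi' fun _ : Fin N => Set.finite_Iio q).subset fun _ hy i => (hy.1 i).2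

lemma injective_of_lt_ne {N : ℕ} {α : Type*} {y : Fin N → α} (h : ∀ a b, a < b → y b ≠ y a) :
    Function.Injective y := by
  intro a b hab
  by_contra hne
  rcases lt_or_gt_of_ne hne with h' | h'
  · exact h _ _ h' hab.symm
  · exact h _ _ h' hab

lemma sigma_subtype_ext {α β : Type*} {S : Set α} {r : S → β → Prop}
    {x y : Σ a : S, {b // r a b}} (h₁ : x.1.1 = y.1.1) (h₂ : x.2.1 = y.2.1) : x = y := by
  obtain ⟨⟨a, _⟩, b, _⟩ := x
  obtain ⟨⟨a', _⟩, b', _⟩ := y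
  obtain rfl : a = a' := h₁
  obtain rfl : b = b' := h₂
  rfl

/-- Removing the largest label and its position leaves a placement with a marked empty position:
the one just before the removed label. -/
def linearPlacementsEquiv (N q : ℕ) :
    linearPlacements (N + 1) (q + 1) ≃
      Σ y : linearPlacements N q, {e : ℕ // e < q ∧ ∀ i, y.1 i ≠ e} where
  toFun y :=
    ⟨⟨fun i => if y.1 i.castSucc < y.1 (Fin.last N) then y.1 i.castSucc else y.1 i.castSucc - 1, by
      obtain ⟨y, hy, h⟩ := y
      refine ⟨fun i => ?_, fun a b hab => ?_⟩
      · have h1 := hy i.castSucc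
        have h2 := hy (Fin.last N)
        have h3 := h _ _ (Fin.castSucc_lt_last i)
        dsimp only
        split_ifs <;> omega
      · have h1 := h _ _ (Fin.castSucc_lt_last a)
        have h2 := h _ _ (Fin.castSucc_lt_last b)
        have h3 := h _ _ (Fin.castSucc_lt_castSucc_iff.2 hab)
        dsimp only
        split_ifs <;> omega⟩,
    ⟨y.1 (Fin.last N) - 1, by
      obtain ⟨y, hy, h⟩ := y
      refine ⟨?_, fun i => ?_⟩
      · have h2 := hy (Fin.last N)
        dsimp only
        omega
      · have h1 := hy i.castSucc
        have h2 := hy (Fin.last N)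
        have h3 := h _ _ (Fin.castSucc_lt_last i)
        dsimp only
        split_ifs <;> omega⟩⟩
  invFun p :=
    ⟨Fin.snoc (α := fun _ => ℕ) (fun i => if p.1.1 i < p.2.1 then p.1.1 i else p.1.1 i + 1)
      (p.2.1 + 1), by
      obtain ⟨⟨y, hy, h⟩, ⟨e, he, hne⟩⟩ := p
      refine ⟨fun i => ?_, fun a b hab => ?_⟩
      · induction i using Fin.lastCases with
        | last => simp; omega
        | cast i =>
          have h1 := hy i
          simp only [Fin.snoc_castSucc]
          split_ifs <;> omega
      · induction b using Fin.lastCases with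
        | last =>
          induction a using Fin.lastCases with
          | last => exact absurd hab (lt_irrefl _)
          | cast a =>
            have h1 := hne a
            simp only [Fin.snoc_castSucc, Fin.snoc_last] at h1 ⊢
            split_ifs <;> omega
        | cast b =>
          induction a using Fin.lastCases with
          | last => exact absurd hab (Fin.castSucc_lt_last b).not_gt
          | cast a =>
            have h1 := hne a
            have h2 := hne b
            have h3 := h a b (Fin.castSucc_lt_castSucc_iff.1 hab)
            simp only [Fin.snoc_castSucc] at h1 h2 ⊢
            split_ifs <;> omega⟩
  left_inv := by
    rintro ⟨y, hy, h⟩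
    apply Subtype.ext
    funext i
    have h2 := hy (Fin.last N)
    induction i using Fin.lastCases with
    | last => simp; omega
    | cast i =>
      have h1 := hy i.castSucc
      have h3 := h _ _ (Fin.castSucc_lt_last i)
      simp only [Fin.snoc_castSucc]
      split_ifs <;> omega
  right_inv := by
    rintro ⟨⟨y, hy, h⟩, ⟨e, he, hne⟩⟩
    refine sigma_subtype_ext (funext fun i => ?_) (by simp)
    have h1 := hne i
    simp only [Fin.snoc_castSucc, Fin.snoc_last] at h1 ⊢
    split_ifs <;> omega

lemma card_compl_range {N : ℕ} {α : Type*} {y : Fin N → α} (hy : Function.Injective y)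
    {s : Set α} (hys : ∀ i, y i ∈ s) :
    Nat.card {e // e ∈ s ∧ ∀ i, y i ≠ e} = s.ncard - N := by
  have : {e | e ∈ s ∧ ∀ i, y i ≠ e} = s \ Set.range y := by
    ext e
    simp
  change Nat.card ↥{e | e ∈ s ∧ ∀ i, y i ≠ e} = _
  rw [this, Nat.card_coe_set_eq, Set.ncard_sdiff (Set.range_subset_iff.2 hys),
    ← Nat.card_coe_set_eq (Set.range y), Nat.card_range_of_injective hy, Nat.card_fin]

lemma card_linearPlacements (N M : ℕ) (hM : 0 < M) :
    Nat.card (linearPlacements N (M + N)) = M ^ N := by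
  induction N with
  | zero =>
    have : linearPlacements 0 (M + 0) = Set.univ := by
      ext y
      simp [linearPlacements]
    rw [this]
    simp
  | succ N ih =>
    have := (finite_linearPlacements N (M + N)).fintype
    have hfiber (y : linearPlacements N (M + N)) :
        Nat.card {e : ℕ // e < M + N ∧ ∀ i, y.1 i ≠ e} = M := by
      have := card_compl_range (injective_of_lt_ne fun a b hab => (y.2.2 a b hab).1)
        (s := Set.Iio (M + N)) (fun i => (y.2.1 i).2)
      simpa [← Nat.card_coe_set_eq] using this
    have (y : linearPlacements N (M + N)) :
        Finite {e : ℕ // e < M + N ∧ ∀ i, y.1 i ≠ e} :=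
      Nat.finite_of_card_ne_zero (by rw [hfiber]; omega)
    rw [← add_assoc, Nat.card_congr (linearPlacementsEquiv N (M + N)), Nat.card_sigma]
    simp only [hfiber, Finset.sum_const, smul_eq_mul, Finset.card_univ]
    rw [← Nat.card_eq_fintype_card, ih, pow_succ]

/-- Points modulo `q` avoiding the Shi arrangement. -/
def shiPoints (N q : ℕ) : Set (Fin N → ZMod q) :=
  {z | ∀ a b, a < b → z b - z a ≠ 0 ∧ z b - z a ≠ 1}

/-- Translating a chosen empty position to `0`. -/
def shiPointsEquiv (N q : ℕ) :
    (Σ z : shiPoints N q, {e : ZMod q // e ∈ Set.univ ∧ ∀ i, z.1 i ≠ e}) ≃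
      {z : Fin N → ZMod q // z ∈ shiPoints N q ∧ ∀ i, z i ≠ 0} × ZMod q where
  toFun p := ⟨⟨fun i => p.1.1 i - p.2.1, fun a b hab => by
    simpa using p.1.2 a b hab, fun i => sub_ne_zero.2 (p.2.2.2 i)⟩, p.2.1⟩
  invFun p := ⟨⟨fun i => p.1.1 i + p.2, fun a b hab => by
    simpa using p.1.2.1 a b hab⟩, ⟨p.2, trivial, fun i => by simpa using p.1.2.2 i⟩⟩
  left_inv := by
    rintro ⟨⟨z, hz⟩, ⟨e, -, he⟩⟩
    exact sigma_subtype_ext (by simp) rfl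
  right_inv := by
    rintro ⟨⟨z, hz⟩, e⟩
    simp

/-- Points modulo `q` with nonzero coordinates, seen as linear placements. -/
def shiPointsNonzeroEquiv (N q : ℕ) [NeZero q] :
    {z : Fin N → ZMod q // z ∈ shiPoints N q ∧ ∀ i, z i ≠ 0} ≃ linearPlacements N q where
  toFun z := ⟨fun i => (z.1 i).val, fun i =>
    ⟨Nat.pos_of_ne_zero fun h => z.2.2 i ((ZMod.val_eq_zero _).1 h), ZMod.val_lt _⟩,
    fun a b hab => ⟨fun h => (z.2.1 a b hab).1 (sub_eq_zero.2 (ZMod.val_injective q h)),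
      fun h => (z.2.1 a b hab).2 (by
        have h' := congrArg (Nat.cast : ℕ → ZMod q) h
        simp only [Nat.cast_add, ZMod.natCast_zmod_val, Nat.cast_one] at h'
        rw [h', add_sub_cancel_left])⟩⟩
  invFun y := ⟨fun i => (y.1 i : ZMod q), fun a b hab => by
    have ha := y.2.1 a
    have hb := y.2.1 b
    have h := y.2.2 a b hab
    constructor
    · rw [Ne, sub_eq_zero, ZMod.natCast_eq_natCast_iff', Nat.mod_eq_of_lt ha.2,
        Nat.mod_eq_of_lt hb.2]
      exact h.1
    · rw [Ne, sub_eq_iff_eq_add', ← Nat.cast_add_one, ZMod.natCast_eq_natCast_iff',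
        Nat.mod_eq_of_lt hb.2]
      rcases Nat.lt_or_ge (y.1 a + 1) q with h' | h'
      · rw [Nat.mod_eq_of_lt h']
        exact h.2
      · rw [show y.1 a + 1 = q by omega, Nat.mod_self]
        omega, fun i => by
    have hi := y.2.1 i
    rw [Ne, ZMod.natCast_eq_zero_iff]
    exact Nat.not_dvd_of_pos_of_lt hi.1 hi.2⟩
  left_inv z := by
    simp
  right_inv y := by
    apply Subtype.ext
    funext i
    exact ZMod.val_cast_of_lt (y.2.1 i).2

lemma card_shiPoints_mul (N M : ℕ) (hM : 0 < M) :
    Nat.card (shiPoints N (M + N)) * M = M ^ N * (M + N) := by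
  have : NeZero (M + N) := ⟨by omega⟩
  have := Fintype.ofFinite (shiPoints N (M + N))
  rw [← card_linearPlacements N M hM, ← Nat.card_congr (shiPointsNonzeroEquiv N (M + N))]
  have hprod := Nat.card_prod {z : Fin N → ZMod (M + N) // z ∈ shiPoints N (M + N) ∧ ∀ i, z i ≠ 0}
    (ZMod (M + N))
  rw [Nat.card_zmod] at hprod
  rw [← hprod, ← Nat.card_congr (shiPointsEquiv N (M + N)), Nat.card_sigma]
  have hfiber (z : shiPoints N (M + N)) :
      Nat.card {e : ZMod (M + N) // e ∈ Set.univ ∧ ∀ i, z.1 i ≠ e} = M := by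
    rw [card_compl_range
      (injective_of_lt_ne fun a b hab h => (z.2 a b hab).1 (sub_eq_zero.2 h))
      fun i => Set.mem_univ (z.1 i), Set.ncard_univ, Nat.card_zmod, Nat.add_sub_cancel]
  simp only [hfiber, Finset.sum_const, smul_eq_mul, Finset.card_univ, Nat.card_eq_fintype_card]

end Counting

/-- The Shi arrangement on `N` coordinates. -/
noncomputable def shiList (N : ℕ) : List (Fin N × Fin N × ℤ) :=
  (Finset.univ.filter fun t : Fin N × Fin N × Fin 2 => t.1 < t.2.1).toList.map
    fun t => (t.1, t.2.1, (t.2.2 : ℤ))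

lemma avoids_shiList {K : Type*} [Ring K] (N : ℕ) (z : Fin N → K) :
    Avoids (shiList N) z ↔ ∀ a b, a < b → z b - z a ≠ 0 ∧ z b - z a ≠ 1 := by
  simp only [Avoids, shiList, List.forall_mem_map, Finset.mem_toList, Finset.mem_filter,
    Finset.mem_univ, true_and, Prod.forall, Fin.forall_fin_two]
  simp
  grind

lemma ncard_regions_shiList (n : ℕ) : (regions (shiList (n + 1))).ncard = (n + 2) ^ n := by
  obtain ⟨P, hP, hr⟩ := exists_characteristic_polynomial (shiList (n + 1))
  have hPeq : P = X * (X - C ((n : ℤ) + 1)) ^ n := by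
    apply Polynomial.eq_of_infinite_eval_eq
    obtain ⟨q₀, hq₀⟩ := eventually_atTop.1 hP
    refine Set.infinite_of_injective_forall_mem
      (f := fun k : ℕ => ((q₀ + k + 1 + (n + 1) : ℕ) : ℤ)) (fun i j h => by simpa using h) ?_
    intro k
    have h := hq₀ (q₀ + k + 1 + (n + 1)) (by omega)
    have hc := card_shiPoints_mul (n + 1) (q₀ + k + 1) (by omega)
    have hset : {z : Fin (n + 1) → ZMod (q₀ + k + 1 + (n + 1)) | Avoids (shiList (n + 1)) z} =
        shiPoints (n + 1) (q₀ + k + 1 + (n + 1)) := by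
      ext z
      exact avoids_shiList _ z
    rw [hset, ← Nat.card_coe_set_eq] at h
    rw [Set.mem_ofPred_eq, ← h]
    have hne : ((q₀ + k + 1 : ℕ) : ℤ) ≠ 0 := by positivity
    apply mul_right_cancel₀ hne
    rw [← Nat.cast_mul, hc]
    simp
    ring
  rw [hPeq] at hr
  have : ((regions (shiList (n + 1))).ncard : ℤ) = ((n + 2) ^ n : ℕ) := by
    rw [hr]
    simp only [Fintype.card_fin, eval_mul, eval_X, eval_pow, eval_sub, eval_C]
    rw [show (-1 : ℤ) - (n + 1) = (-1) * (n + 2) by ring, mul_pow, pow_succ]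
    push_cast
    have : ((-1 : ℤ) ^ n) * (-1) ^ n = 1 := by rw [← mul_pow]; simp
    linear_combination ((n : ℤ) + 2) ^ n * this
  exact_mod_cast this

lemma card_connectedComponents_eq_ncard_range {X β : Type*} [TopologicalSpace X] (s : X → β)
    (hs : IsLocallyConstant s) (hconn : ∀ x, IsPreconnected (s ⁻¹' {s x})) :
    Nat.card (ConnectedComponents X) = (Set.range s).ncard := by
  rw [← Nat.card_coe_set_eq]
  let f : ConnectedComponents X → Set.range s :=
    Quotient.lift (fun x => (⟨s x, x, rfl⟩ : Set.range s)) fun x y h => Subtype.ext <| by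
      have hy : y ∈ connectedComponent x := by
        rw [show connectedComponent x = connectedComponent y from h]
        exact mem_connectedComponent
      exact hs.apply_eq_of_isPreconnected isPreconnected_connectedComponent
        mem_connectedComponent hy
  refine Nat.card_eq_of_bijective f ⟨?_, ?_⟩
  · intro x y
    obtain ⟨x, rfl⟩ := ConnectedComponents.surjective_coe x
    obtain ⟨y, rfl⟩ := ConnectedComponents.surjective_coe y
    intro h
    have h' : s x = s y := congrArg Subtype.val h
    rw [ConnectedComponents.coe_eq_coe']
    exact (hconn y).subset_connectedComponent rfl h'
  · rintro ⟨_, x, rfl⟩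
    exact ⟨(x : ConnectedComponents X), rfl⟩

lemma sub_eq_sub_of_mkQ_eq {n : ℕ} {z w : Fin (n + 1) → ℝ}
    (h : (diagLine n).mkQ z = (diagLine n).mkQ w) (a b : Fin (n + 1)) :
    z b - z a = w b - w a := by
  rw [Submodule.mkQ_apply, Submodule.mkQ_apply, Submodule.Quotient.eq, diagLine,
    Submodule.mem_span_singleton] at h
  obtain ⟨c, hc⟩ := h
  have ha := congrFun hc a
  have hb := congrFun hc b
  simp only [Pi.smul_apply, Pi.sub_apply, smul_eq_mul] at ha hb
  linarith

/-- **Regions of the Shi arrangement.** The complement in `ℝ^{n+1}/ℝ·(1,…,1)` of the Shi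
arrangement (the hyperplanes `z_b - z_a = 0` and `z_b - z_a = 1` for `a < b`) has exactly
`(n+2)^n` connected components. -/
theorem shi_arrangement_regions (n : ℕ) :
    Nat.card (ConnectedComponents
      ((diagLine n).mkQ ''
        {z : Fin (n + 1) → ℝ |
          ∀ a b : Fin (n + 1), a < b → z b - z a ≠ 0 ∧ z b - z a ≠ 1})) =
      (n + 2) ^ n := by
  set S : Set (Fin (n + 1) → ℝ) :=
    {z | ∀ a b : Fin (n + 1), a < b → z b - z a ≠ 0 ∧ z b - z a ≠ 1}
  have hSA (z : Fin (n + 1) → ℝ) : z ∈ S ↔ Avoids (shiList (n + 1)) z :=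
    (avoids_shiList _ z).symm
  let s : (diagLine n).mkQ '' S → List Prop := fun x => signs (shiList (n + 1)) x.2.choose
  have hs (z : Fin (n + 1) → ℝ) (hz : (diagLine n).mkQ z ∈ (diagLine n).mkQ '' S) :
      s ⟨_, hz⟩ = signs (shiList (n + 1)) z := by
    rw [signs_eq_iff]
    intro t _
    rw [sub_eq_sub_of_mkQ_eq hz.choose_spec.2]
  have hfiber (σ : List Prop) : s ⁻¹' {σ} = Subtype.val ⁻¹' ((diagLine n).mkQ ''
      {z | Avoids (shiList (n + 1)) z ∧ signs (shiList (n + 1)) z = σ}) := by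
    ext ⟨_, z, hz, rfl⟩
    rw [Set.mem_preimage, hs z ⟨z, hz, rfl⟩, Set.mem_singleton_iff]
    constructor
    · exact fun h => ⟨z, ⟨(hSA z).1 hz, h⟩, rfl⟩
    · rintro ⟨w, ⟨-, rfl⟩, h⟩
      rw [signs_eq_iff]
      intro t _
      rw [sub_eq_sub_of_mkQ_eq h]
  have hrange : Set.range s = regions (shiList (n + 1)) := by
    ext σ
    constructor
    · rintro ⟨⟨_, z, hz, rfl⟩, rfl⟩
      exact ⟨z, (hSA z).1 hz, (hs z _).symm⟩
    · rintro ⟨z, hz, rfl⟩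
      exact ⟨⟨_, z, (hSA z).2 hz, rfl⟩, hs z _⟩
  rw [card_connectedComponents_eq_ncard_range s, hrange, ncard_regions_shiList]
  · rw [IsLocallyConstant.iff_isOpen_fiber]
    intro σ
    have := (diagLine n).isOpenMap_mkQ _ (isOpen_avoids_signs_eq (shiList (n + 1)) σ)
    rw [hfiber]
    exact this.preimage continuous_subtype_val
  · intro x
    rw [hfiber, ← Topology.IsInducing.subtypeVal.isPreconnected_image,
      Set.image_preimage_eq_of_subset]
    · exact (convex_avoids_signs_eq _ _).isPreconnected.image _
        (Submodule.continuous_mkQ _).continuousOn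
    · rw [Subtype.range_coe]
      exact Set.image_mono fun z hz => (hSA z).2 hz.1
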